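/- arXiv:1803.02466 — 2 statements merged into one kernel-verified Lean document; each statement's English description precedes it below -/
import Mathlib

section
/- Fix real numbers ε, δz and an integer L with 0 < ε ≤ 1/5, 0 < δz ≤ π/√(2·log(20/ε)), L ≥ 2 and (L−1)·δz ≥ √(2·log(20/ε)). Then |(δz/√(2π)) · ∑_{l=−L}^{L−1} exp(−(l·δz)²/2) − 1| ≤ ε. -/
open Finset in
theorem sum_Icc_neg_eq_sum_range_add (f : ℤ → ℝ) (N : ℕ) :
    ∑ l ∈ Icc (-(N : ℤ)) (N - 1), f l =
      ∑ n ∈ range N, f n + ∑ n ∈ range N, f (-((n : ℤ) + 1)) := by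
  induction N with
  | zero => simp
  | succ N ih =>
    have h : Icc (-((N + 1 : ℕ) : ℤ)) ((N + 1 : ℕ) - 1) =
        insert (N : ℤ) (insert (-((N : ℤ) + 1)) (Icc (-(N : ℤ)) (N - 1))) := by
      ext x
      simp only [mem_Icc, mem_insert]
      omega
    rw [h, sum_insert (by simp only [mem_Icc, mem_insert]; omega),
      sum_insert (by simp only [mem_Icc]; omega), ih, sum_range_succ, sum_range_succ]
    ring

theorem summable_exp_neg_mul_nat_sq {b : ℝ} (hb : 0 < b) :
    Summable fun n : ℕ => Real.exp (-b * (n : ℝ) ^ 2) := by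
  refine Summable.of_nonneg_of_le (fun _ => (Real.exp_pos _).le) (fun n => ?_)
    (Real.summable_exp_nat_mul_iff.2 (neg_lt_zero.2 hb))
  have h : (n : ℝ) ≤ (n : ℝ) ^ 2 := by exact_mod_cast Nat.le_self_pow two_ne_zero n
  exact Real.exp_le_exp.2 (by nlinarith)

theorem summable_exp_neg_mul_int_sq {b : ℝ} (hb : 0 < b) :
    Summable fun n : ℤ => Real.exp (-b * (n : ℝ) ^ 2) :=
  Summable.of_nat_of_neg (by simpa using summable_exp_neg_mul_nat_sq hb)
    (by simpa using summable_exp_neg_mul_nat_sq hb)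

/-- One-sided tail bound for a discrete Gaussian sum, by comparison with a geometric series. -/
theorem tsum_exp_neg_mul_nat_sq_tail_le {b : ℝ} (hb : 0 < b) (M : ℕ) :
    ∑' n : ℕ, Real.exp (-b * ((n + (M + 1) : ℕ) : ℝ) ^ 2) ≤
      Real.exp (-b * (M : ℝ) ^ 2) / (Real.exp (b * (2 * M + 1)) - 1) := by
  set t := b * (2 * (M : ℝ) + 1) with ht
  have htpos : 0 < t := by positivity
  have hlt : Real.exp (-t) < 1 := Real.exp_lt_one_iff.2 (neg_lt_zero.2 htpos)
  have hgeo := (hasSum_geometric_of_lt_one (Real.exp_pos (-t)).le hlt).mul_left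
    (Real.exp (-b * (M : ℝ) ^ 2) * Real.exp (-t))
  have hval : Real.exp (-b * (M : ℝ) ^ 2) * Real.exp (-t) * (1 - Real.exp (-t))⁻¹ =
      Real.exp (-b * (M : ℝ) ^ 2) / (Real.exp t - 1) := by
    have h1 : Real.exp t - 1 ≠ 0 := (sub_pos.2 (Real.one_lt_exp_iff.2 htpos)).ne'
    rw [Real.exp_neg t]
    field_simp
  rw [← hval, ← hgeo.tsum_eq]
  refine Summable.tsum_le_tsum (fun n => ?_)
    ((summable_nat_add_iff (M + 1)).2 (summable_exp_neg_mul_nat_sq hb)) hgeo.summable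
  rw [← Real.exp_nat_mul, ← Real.exp_add, ← Real.exp_add, Real.exp_le_exp, ht]
  push_cast
  nlinarith [mul_nonneg hb.le (mul_nonneg n.cast_nonneg (by positivity : (0 : ℝ) ≤ n + 1))]

theorem tsum_exp_neg_mul_int_sq_le {b : ℝ} (hb : 0 < b) (M : ℕ) :
    ∑' n : ℤ, Real.exp (-b * (n : ℝ) ^ 2) ≤
      ∑ l ∈ Finset.Icc (-((M + 1 : ℕ) : ℤ)) ((M + 1 : ℕ) - 1), Real.exp (-b * (l : ℝ) ^ 2) +
        2 * (Real.exp (-b * (M : ℝ) ^ 2) / (Real.exp (b * (2 * M + 1)) - 1)) := by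
  have hs := summable_exp_neg_mul_nat_sq hb
  have hs' : Summable fun n : ℕ => Real.exp (-b * ((n + 1 : ℕ) : ℝ) ^ 2) :=
    (summable_nat_add_iff 1).2 hs
  have hneg (n : ℕ) : Real.exp (-b * ((-((n : ℤ) + 1) : ℤ) : ℝ) ^ 2) =
      Real.exp (-b * ((n + 1 : ℕ) : ℝ) ^ 2) := by
    push_cast
    ring_nf
  have hsplit := tsum_of_nat_of_neg_add_one (f := fun n : ℤ => Real.exp (-b * (n : ℝ) ^ 2))
    (by simpa using hs) (by simpa only [hneg] using hs')
  rw [hsplit, sum_Icc_neg_eq_sum_range_add]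
  simp only [hneg, Int.cast_natCast]
  have e1 := hs.sum_add_tsum_nat_add (M + 1)
  have e2 := hs'.sum_add_tsum_nat_add (M + 1)
  have h1 := tsum_exp_neg_mul_nat_sq_tail_le hb M
  have h2 : ∑' n : ℕ, Real.exp (-b * ((n + (M + 1) + 1 : ℕ) : ℝ) ^ 2) ≤
      ∑' n : ℕ, Real.exp (-b * ((n + (M + 1) : ℕ) : ℝ) ^ 2) := by
    have hshift (k : ℕ) : Summable fun n : ℕ => Real.exp (-b * ((n + k : ℕ) : ℝ) ^ 2) :=
      (summable_nat_add_iff (f := fun n : ℕ => Real.exp (-b * (n : ℝ) ^ 2)) k).2 hs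
    refine Summable.tsum_le_tsum (fun n => ?_) (hshift (M + 1 + 1)) (hshift (M + 1))
    have hle : ((n + (M + 1) : ℕ) : ℝ) ≤ (n + (M + 1) + 1 : ℕ) := by
      exact_mod_cast Nat.le_succ _
    rw [Real.exp_le_exp, neg_mul, neg_mul, neg_le_neg_iff]
    gcongr
  linarith

/-- λ = 0 case of Lemma 1: for `0 < ε ≤ 1/5`,
`0 < δz ≤ π/√(2 log(20/ε))`, an integer `L ≥ 2` with `(L−1)·δz ≥ √(2 log(20/ε))`,
the truncated discrete Gaussian sum approximates 1:
`|(δz/√(2π)) ∑_{l=−L}^{L−1} exp(−(l δz)²/2) − 1| ≤ ε`. -/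
theorem stmt_1 (ε δz : ℝ) (L : ℤ)
    (hε : 0 < ε) (hε' : ε ≤ 1 / 5)
    (hδz : 0 < δz) (hδz' : δz ≤ Real.pi / Real.sqrt (2 * Real.log (20 / ε)))
    (hL : 2 ≤ L) (hLδz : Real.sqrt (2 * Real.log (20 / ε)) ≤ ((L : ℝ) - 1) * δz) :
    |δz / Real.sqrt (2 * Real.pi) *
        (∑ l ∈ Finset.Icc (-L) (L - 1), Real.exp (-((l : ℝ) * δz) ^ 2 / 2)) - 1| ≤ ε := by
  set s := Real.sqrt (2 * Real.log (20 / ε)) with hs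
  set r := Real.sqrt (2 * Real.pi) with hr
  have hpi := Real.pi_gt_three
  have h100 : 100 ≤ 20 / ε := by rw [le_div_iff₀ hε]; linarith
  have hlog : 1 ≤ Real.log (20 / ε) := by
    rw [Real.le_log_iff_exp_le (by positivity)]
    linarith [Real.exp_one_lt_d9]
  have hs2 : s ^ 2 = 2 * Real.log (20 / ε) := Real.sq_sqrt (by linarith)
  have hs1 : 1 ≤ s := Real.one_le_sqrt.2 (by linarith)
  have hr2 : r ^ 2 = 2 * Real.pi := Real.sq_sqrt (by positivity)
  have hr1 : 1 ≤ r := Real.one_le_sqrt.2 (by linarith)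
  have hexps : Real.exp (s ^ 2 / 2) = 20 / ε := by
    rw [hs2, mul_div_cancel_left₀ _ two_ne_zero, Real.exp_log (by positivity)]
  have hexpneg : Real.exp (-(s ^ 2 / 2)) = ε / 20 := by rw [Real.exp_neg, hexps, inv_div]
  obtain ⟨M, rfl⟩ : ∃ M : ℕ, L = (M + 1 : ℕ) := ⟨(L - 1).toNat, by omega⟩
  have hM : s ≤ M * δz := by simpa using hLδz
  set b := δz ^ 2 / 2 with hb
  have hbpos : 0 < b := by positivity
  set c := 2 * Real.pi ^ 2 / δz ^ 2 with hc
  have hcpos : 0 < c := by positivity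
  have hterm (l : ℤ) : Real.exp (-((l : ℝ) * δz) ^ 2 / 2) = Real.exp (-b * (l : ℝ) ^ 2) := by
    rw [hb]; ring_nf
  simp only [hterm]
  set S := ∑ l ∈ Finset.Icc (-((M + 1 : ℕ) : ℤ)) ((M + 1 : ℕ) - 1), Real.exp (-b * (l : ℝ) ^ 2)
  set T := ∑' n : ℤ, Real.exp (-b * (n : ℝ) ^ 2)
  have hpoisson : δz / r * T = ∑' n : ℤ, Real.exp (-c * (n : ℝ) ^ 2) := by
    have h := Real.tsum_exp_neg_mul_int_sq (a := (δz / r) ^ 2) (by positivity)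
    rw [← Real.sqrt_eq_rpow, Real.sqrt_sq (by positivity)] at h
    have e1 : -Real.pi * (δz / r) ^ 2 = -b := by
      rw [div_pow, hr2, hb]; field_simp
    have e2 : -Real.pi / (δz / r) ^ 2 = -c := by
      rw [div_pow, hr2, hc]; field_simp
    rw [e1, e2] at h
    simp only [T]
    rw [h]
    field_simp
  have hST : S ≤ T :=
    (summable_exp_neg_mul_int_sq hbpos).sum_le_tsum _ fun _ _ => (Real.exp_pos _).le
  have hone : 1 ≤ δz / r * T := by
    rw [hpoisson]
    simpa using (summable_exp_neg_mul_int_sq hcpos).sum_le_tsum {0} fun _ _ => (Real.exp_pos _).le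
  have hcs : s ^ 2 / 2 ≤ c := by
    rw [le_div_iff₀ (by linarith)] at hδz'
    rw [hc, le_div_iff₀ (by positivity)]
    nlinarith [mul_self_le_mul_self (by positivity) hδz']
  have hdual : δz / r * T ≤ 1 + ε := by
    have h := tsum_exp_neg_mul_int_sq_le hcpos 0
    rw [← hpoisson, sum_Icc_neg_eq_sum_range_add] at h
    simp only [zero_add, Finset.range_one, Finset.sum_singleton, Nat.cast_zero, Int.cast_zero,
      Int.cast_neg, Int.cast_one, neg_sq, one_pow, ne_eq, OfNat.ofNat_ne_zero, not_false_eq_true,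
      zero_pow, mul_zero, mul_one, Real.exp_zero] at h
    have h1 : Real.exp (-c) ≤ ε / 20 := hexpneg ▸ Real.exp_le_exp.2 (neg_le_neg hcs)
    have h2 : 20 / ε ≤ Real.exp c := hexps ▸ Real.exp_le_exp.2 hcs
    have h3 : 1 / (Real.exp c - 1) ≤ ε / 10 := by
      have h4 : 10 / ε ≤ Real.exp c - 1 := by
        have : 20 / ε = 2 * (10 / ε) := by ring
        linarith
      calc 1 / (Real.exp c - 1) ≤ 1 / (10 / ε) := by gcongr
        _ = ε / 10 := one_div_div _ _
    linarith
  have htail : δz / r * T ≤ δz / r * S + ε := by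
    have h := tsum_exp_neg_mul_int_sq_le hbpos M
    have h1 : Real.exp (-b * (M : ℝ) ^ 2) ≤ ε / 20 := by
      rw [← hexpneg, Real.exp_le_exp, hb]
      nlinarith [mul_self_le_mul_self (by positivity) hM]
    have h2 : δz ≤ Real.exp (b * (2 * M + 1)) - 1 := by
      have h3 := Real.add_one_le_exp (b * (2 * M + 1))
      have h4 : b * (2 * M + 1) = δz * (M * δz) + b := by rw [hb]; ring
      nlinarith
    have h5 : Real.exp (-b * (M : ℝ) ^ 2) / (Real.exp (b * (2 * M + 1)) - 1) ≤ ε / 20 / δz := by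
      gcongr
    calc δz / r * T ≤ δz / r * (S + 2 * (ε / 20 / δz)) := by
          gcongr
          linarith
      _ = δz / r * S + ε / 10 / r := by field_simp; ring
      _ ≤ δz / r * S + ε := by
          gcongr
          rw [div_le_iff₀ (by positivity)]
          nlinarith
  have hle : δz / r * S ≤ δz / r * T := by gcongr
  rw [abs_le]
  constructor <;> linarith
end

section
/- Let H be a finite-dimensional complex inner product space and U a unitary operator on H. Fix real numbers ε, Δ, δz with 0 < ε ≤ 1/5, 0 < Δ ≤ π, 0 < δz ≤ Δ/√(2·log(20/ε)), and an integer L ≥ 2 with (L−1)·δz ≥ √(2·log(20/ε)). Set α_l := (δz/√(2π))·exp(−(l·δz)²/2) for l ∈ ℤ. Then: (i) for every unit vector ψ₀ ∈ H with U ψ₀ = ψ₀, ‖∑_{l=−L}^{L−1} α_l U^l ψ₀ − ψ₀‖ ≤ ε; and (ii) for every unit vector ψ ∈ H with U ψ = e^{iλ} ψ for some real λ satisfying Δ ≤ λ ≤ 2π − Δ, ‖∑_{l=−L}^{L−1} α_l U^l ψ‖ ≤ ε. -/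
/-- The Gaussian weight `δ / √(2π) * exp (-(l δ)² / 2)`. -/
noncomputable def gaussianWeight (δ : ℝ) (l : ℤ) : ℝ :=
  δ / Real.sqrt (2 * Real.pi) * Real.exp (-((l : ℝ) * δ) ^ 2 / 2)

lemma gaussianWeight_nonneg {δ : ℝ} (hδ : 0 < δ) (l : ℤ) : 0 ≤ gaussianWeight δ l := by
  unfold gaussianWeight; positivity

/-- A Gaussian weight beyond `s` decays geometrically. -/
lemma gaussianWeight_le {δ s : ℝ} (hδ : 0 < δ) (hs : 0 < s) (k : ℕ) {l : ℤ}
    (hl : s + (k + 1) * δ ≤ |(l : ℝ)| * δ) :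
    gaussianWeight δ l ≤ δ / Real.sqrt (2 * Real.pi) * Real.exp (-s ^ 2 / 2) *
      Real.exp (-(s * δ)) * Real.exp (-(s * δ)) ^ k := by
  unfold gaussianWeight
  rw [← Real.exp_nat_mul, mul_assoc, mul_assoc, ← Real.exp_add, ← Real.exp_add]
  gcongr
  have h1 : (s + (k + 1) * δ) ^ 2 ≤ ((l : ℝ) * δ) ^ 2 := by
    calc (s + (k + 1) * δ) ^ 2 ≤ (|(l : ℝ)| * δ) ^ 2 := by gcongr
      _ = _ := by rw [mul_pow, mul_pow, sq_abs]
  nlinarith [sq_nonneg ((k + 1) * δ)]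

lemma summable_gaussianWeight {δ : ℝ} (hδ : 0 < δ) : Summable (gaussianWeight δ) := by
  have hr : Real.exp (-(1 * δ)) < 1 := by rw [Real.exp_lt_one_iff]; linarith
  obtain ⟨M, hM⟩ := exists_nat_gt ((1 + δ) / δ)
  rw [div_lt_iff₀ hδ] at hM
  have hg := (summable_geometric_of_lt_one (Real.exp_pos _).le hr).mul_left
    (δ / Real.sqrt (2 * Real.pi) * Real.exp (-1 ^ 2 / 2) * Real.exp (-(1 * δ)))
  apply Summable.of_nat_of_neg_add_one
  · rw [← summable_nat_add_iff M]
    refine Summable.of_nonneg_of_le (fun k => gaussianWeight_nonneg hδ _)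
      (fun k => gaussianWeight_le hδ one_pos k ?_) hg
    push_cast
    rw [abs_of_nonneg (by positivity)]
    nlinarith
  · rw [← summable_nat_add_iff M]
    refine Summable.of_nonneg_of_le (fun k => gaussianWeight_nonneg hδ _)
      (fun k => gaussianWeight_le hδ one_pos k ?_) hg
    push_cast
    rw [abs_neg, abs_of_nonneg (by positivity)]
    nlinarith

lemma sum_Icc_neg_eq_sum_range {E : Type*} [AddCommMonoid E] (f : ℤ → E) (M : ℕ) :
    ∑ l ∈ Finset.Icc (-(M : ℤ)) (M - 1), f l =
      ∑ n ∈ Finset.range M, f n + ∑ n ∈ Finset.range M, f (-((n : ℤ) + 1)) := by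
  induction M with
  | zero => simp
  | succ M ih =>
    have h : Finset.Icc (-((M + 1 : ℕ) : ℤ)) ((M + 1 : ℕ) - 1) =
        insert (M : ℤ) (insert (-((M : ℤ) + 1)) (Finset.Icc (-(M : ℤ)) (M - 1))) := by
      ext x; simp only [Finset.mem_Icc, Finset.mem_insert]; omega
    rw [h, Finset.sum_insert, Finset.sum_insert, ih, Finset.sum_range_succ, Finset.sum_range_succ]
    · abel
    · simp only [Finset.mem_Icc]; omega
    · simp only [Finset.mem_Icc, Finset.mem_insert]; omega

/-- The tail of a Gaussian-weighted series with coefficients of norm at most one. -/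
lemma norm_tsum_sub_sum_Icc_le {δ s : ℝ} (hδ : 0 < δ) (hs : 1 ≤ s) {M : ℕ}
    (hM : s ≤ ((M : ℝ) - 1) * δ) (f : ℤ → ℂ) (hf : ∀ l, ‖f l‖ ≤ gaussianWeight δ l) :
    ‖∑' l, f l - ∑ l ∈ Finset.Icc (-(M : ℤ)) (M - 1), f l‖ ≤ 2 * Real.exp (-s ^ 2 / 2) := by
  have hsum : Summable f := Summable.of_norm_bounded (summable_gaussianWeight hδ) hf
  have hs0 : 0 < s := by linarith
  have hr : Real.exp (-(s * δ)) < 1 := by rw [Real.exp_lt_one_iff]; nlinarith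
  have h1 : Summable fun n : ℕ => f n := hsum.comp_injective Nat.cast_injective
  have h2 : Summable fun n : ℕ => f (-((n : ℤ) + 1)) :=
    hsum.comp_injective (i := fun n : ℕ => -((n : ℤ) + 1)) fun a b h => by simpa using h
  rw [tsum_of_nat_of_neg_add_one h1 h2, sum_Icc_neg_eq_sum_range,
    ← h1.sum_add_tsum_nat_add M, ← h2.sum_add_tsum_nat_add M, add_add_add_comm,
    add_sub_cancel_left]
  set A := δ / Real.sqrt (2 * Real.pi) * Real.exp (-s ^ 2 / 2) * Real.exp (-(s * δ)) with hA
  have hg := (hasSum_geometric_of_lt_one (Real.exp_pos _).le hr).mul_left A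
  have hpi : 1 ≤ Real.sqrt (2 * Real.pi) := by
    rw [Real.one_le_sqrt]; linarith [Real.pi_gt_three]
  have hle : A * (1 - Real.exp (-(s * δ)))⁻¹ ≤ Real.exp (-s ^ 2 / 2) := by
    rw [← div_eq_mul_inv, div_le_iff₀ (by linarith)]
    have h3 : δ * Real.exp (-(s * δ)) ≤ 1 - Real.exp (-(s * δ)) := by
      have h4 : 1 + s * δ ≤ Real.exp (s * δ) := by linarith [Real.add_one_le_exp (s * δ)]
      have h5 : Real.exp (s * δ) * Real.exp (-(s * δ)) = 1 := by simp [← Real.exp_add]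
      nlinarith [Real.exp_pos (-(s * δ)), mul_le_mul_of_nonneg_right h4
        (Real.exp_pos (-(s * δ))).le, mul_pos hδ (Real.exp_pos (-(s * δ)))]
    calc A ≤ δ * Real.exp (-s ^ 2 / 2) * Real.exp (-(s * δ)) := by
          rw [hA]; gcongr; exact div_le_self hδ.le hpi
      _ = Real.exp (-s ^ 2 / 2) * (δ * Real.exp (-(s * δ))) := by ring
      _ ≤ _ := by gcongr
  have hb1 := tsum_of_norm_bounded (f := fun k : ℕ => f ((k + M : ℕ) : ℤ)) hg fun k =>
    (hf _).trans <| gaussianWeight_le hδ hs0 k (by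
      push_cast
      rw [abs_of_nonneg (by positivity)]
      nlinarith)
  have hb2 := tsum_of_norm_bounded (f := fun k : ℕ => f (-(((k + M : ℕ) : ℤ) + 1))) hg fun k =>
    (hf _).trans <| gaussianWeight_le hδ hs0 k (by
      push_cast
      rw [abs_neg, abs_of_nonneg (by positivity)]
      nlinarith)
  refine (norm_add_le _ _).trans ?_
  linarith

/-- Poisson summation for the Gaussian-weighted Fourier series. -/
lemma tsum_gaussianWeight_mul_exp {δ : ℝ} (hδ : 0 < δ) (lam : ℝ) :
    ∑' l : ℤ, (gaussianWeight δ l : ℂ) * Complex.exp (Complex.I * lam * l) =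
      ∑' n : ℤ, ((Real.exp (-((2 * Real.pi * n - lam) / δ) ^ 2 / 2) : ℝ) : ℂ) := by
  have hpi := Real.pi_pos
  have hpi0 : (Real.pi : ℂ) ≠ 0 := by exact_mod_cast hpi.ne'
  have hδ0 : (δ : ℂ) ≠ 0 := by exact_mod_cast hδ.ne'
  set a : ℝ := δ ^ 2 / (2 * Real.pi) with ha
  have ha0 : 0 < a := by positivity
  have key := Complex.tsum_exp_neg_quadratic (a := (a : ℂ)) (by simpa using ha0)
    (Complex.I * lam / (2 * Real.pi))
  have hsq : (1 / (a : ℂ) ^ (1 / 2 : ℂ)) = ((Real.sqrt (2 * Real.pi) / δ : ℝ) : ℂ) := by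
    have : ((a ^ (1 / 2 : ℝ) : ℝ) : ℂ) = (a : ℂ) ^ (1 / 2 : ℂ) := by
      rw [Complex.ofReal_cpow ha0.le]; norm_num
    rw [← this, ← Real.sqrt_eq_rpow, ha, Real.sqrt_div (by positivity), Real.sqrt_sq hδ.le]
    push_cast
    rw [one_div_div]
  have hL : ∀ l : ℤ, (gaussianWeight δ l : ℂ) * Complex.exp (Complex.I * lam * l) =
      ((δ / Real.sqrt (2 * Real.pi) : ℝ) : ℂ) * Complex.exp (-Real.pi * a * l ^ 2 +
        2 * Real.pi * (Complex.I * lam / (2 * Real.pi)) * l) := by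
    intro l
    unfold gaussianWeight
    rw [Complex.ofReal_mul, Complex.ofReal_exp, mul_assoc, ← Complex.exp_add]
    congr 2
    rw [ha]
    push_cast
    field_simp
  have hR : ∀ n : ℤ, Complex.exp (-Real.pi / a * (n + Complex.I *
      (Complex.I * lam / (2 * Real.pi))) ^ 2) =
      ((Real.exp (-((2 * Real.pi * n - lam) / δ) ^ 2 / 2) : ℝ) : ℂ) := by
    intro n
    rw [Complex.ofReal_exp]
    congr 1
    have : Complex.I * (Complex.I * lam / (2 * Real.pi)) = -(lam / (2 * Real.pi)) := by
      rw [← mul_div_assoc, ← mul_assoc, Complex.I_mul_I]; ring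
    rw [this, ha]
    push_cast
    field_simp
    ring
  simp_rw [hL, tsum_mul_left, key, hR, hsq, ← mul_assoc, ← Complex.ofReal_mul]
  have : Real.sqrt (2 * Real.pi) ≠ 0 := by positivity
  rw [show δ / Real.sqrt (2 * Real.pi) * (Real.sqrt (2 * Real.pi) / δ) = 1 by field_simp]
  simp

lemma hasSum_geometric_natAbs :
    HasSum (fun n : ℤ => (1 / 10 : ℝ) ^ n.natAbs) (11 / 9) := by
  have hg : HasSum (fun n : ℕ => (1 / 10 : ℝ) ^ n) (1 - 1 / 10)⁻¹ :=
    hasSum_geometric_of_lt_one (by norm_num) (by norm_num)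
  have h := HasSum.of_nat_of_neg_add_one (f := fun n : ℤ => (1 / 10 : ℝ) ^ n.natAbs)
    (by simpa only [Int.natAbs_natCast] using hg)
    (by
      have : ∀ n : ℕ, (-((n : ℤ) + 1)).natAbs = n + 1 := by intro n; omega
      simp only [this, pow_succ]
      exact hg.mul_right _)
  convert h using 1
  norm_num

/-- The Gaussian-weighted truncated Fourier series at `lam` is close to `c` if the only
non-negligible term of the Poisson-dual series is the one at `0`, with value about `c`. -/
lemma norm_sum_gaussianWeight_mul_exp_sub_le {δ s lam c : ℝ} (hδ : 0 < δ) (hs : 1 ≤ s)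
    (hq : Real.exp (-s ^ 2 / 2) ≤ 1 / 10) {M : ℕ} (hM : s ≤ ((M : ℝ) - 1) * δ)
    (h0 : |Real.exp (-(lam / δ) ^ 2 / 2) - c| ≤ Real.exp (-s ^ 2 / 2))
    (hn : ∀ n : ℤ, n ≠ 0 → |(n : ℝ)| * (s * δ) ≤ |2 * Real.pi * n - lam|) :
    ‖∑ l ∈ Finset.Icc (-(M : ℤ)) (M - 1),
      (gaussianWeight δ l : ℂ) * Complex.exp (Complex.I * lam * l) - c‖ ≤
        20 * Real.exp (-s ^ 2 / 2) := by
  set q := Real.exp (-s ^ 2 / 2) with hqdef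
  have hq0 : 0 < q := Real.exp_pos _
  have htail := norm_tsum_sub_sum_Icc_le hδ hs hM
    (fun l => (gaussianWeight δ l : ℂ) * Complex.exp (Complex.I * lam * l)) (by
      intro l
      rw [norm_mul, Complex.norm_real, Real.norm_of_nonneg (gaussianWeight_nonneg hδ l),
        show Complex.I * lam * l = ((lam * l : ℝ) : ℂ) * Complex.I by push_cast; ring,
        Complex.norm_exp_ofReal_mul_I, mul_one])
  rw [tsum_gaussianWeight_mul_exp hδ] at htail
  set g : ℤ → ℝ := fun n => Real.exp (-((2 * Real.pi * n - lam) / δ) ^ 2 / 2) with hg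
  have hbound : ∀ n : ℤ, ‖g n - (Pi.single 0 c : ℤ → ℝ) n‖ ≤
      10 * q * (1 / 10 : ℝ) ^ n.natAbs := by
    intro n
    by_cases hn0 : n = 0
    · subst hn0
      have : g 0 = Real.exp (-(lam / δ) ^ 2 / 2) := by
        simp only [hg]; congr 1; push_cast; ring
      rw [this, Pi.single_eq_same, Real.norm_eq_abs]
      simp only [Int.natAbs_zero, pow_zero]
      linarith
    · rw [Pi.single_eq_of_ne hn0, sub_zero, Real.norm_of_nonneg (Real.exp_pos _).le]
      obtain ⟨k, hk⟩ : ∃ k, n.natAbs = k + 1 := Nat.exists_eq_succ_of_ne_zero (by omega)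
      have habs : |(n : ℝ)| = k + 1 := by
        rw [← Int.cast_abs, Int.abs_eq_natAbs, hk]; push_cast; rfl
      have h1 := hn n hn0
      rw [habs] at h1
      have h2 : ((k + 1) * s) ^ 2 ≤ ((2 * Real.pi * n - lam) / δ) ^ 2 := by
        rw [div_pow, le_div_iff₀ (by positivity), ← mul_pow, ← sq_abs (2 * Real.pi * n - lam),
          mul_assoc]
        gcongr
      calc g n ≤ q ^ (k + 1) := by
            rw [hqdef, ← Real.exp_nat_mul]
            apply Real.exp_le_exp.mpr
            push_cast
            have : (0 : ℝ) ≤ k := by positivity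
            nlinarith [mul_nonneg (mul_nonneg this (by positivity : (0 : ℝ) ≤ k + 1)) (sq_nonneg s)]
        _ = q * q ^ k := by ring
        _ ≤ q * (1 / 10) ^ k := by gcongr
        _ = 10 * q * (1 / 10 : ℝ) ^ n.natAbs := by rw [hk, pow_succ]; ring
  have hB := hasSum_geometric_natAbs.mul_left (10 * q)
  have hsd := Summable.of_norm_bounded hB.summable hbound
  have hc := hasSum_pi_single (0 : ℤ) c
  have hgs : HasSum g (∑' n, (g n - (Pi.single 0 c : ℤ → ℝ) n) + c) := by
    simpa using hsd.hasSum.add hc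
  have hle := tsum_of_norm_bounded hB hbound
  rw [← Complex.ofReal_tsum, hgs.tsum_eq] at htail
  set T := ∑' n, (g n - (Pi.single 0 c : ℤ → ℝ) n)
  set S := ∑ l ∈ Finset.Icc (-(M : ℤ)) (M - 1),
      (gaussianWeight δ l : ℂ) * Complex.exp (Complex.I * lam * l)
  calc ‖S - c‖ = ‖(T : ℂ) - (((T + c : ℝ) : ℂ) - S)‖ := by congr 1; push_cast; ring
    _ ≤ ‖(T : ℂ)‖ + ‖((T + c : ℝ) : ℂ) - S‖ := norm_sub_le _ _
    _ ≤ 10 * q * (11 / 9) + 2 * q := by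
        rw [Complex.norm_real]; exact add_le_add hle htail
    _ ≤ 20 * q := by linarith

lemma zpow_apply_of_apply_eq_exp_smul {H : Type*} [NormedAddCommGroup H]
    [InnerProductSpace ℂ H] (U : H ≃ₗᵢ[ℂ] H) {ψ : H} {z : ℂ}
    (h : U ψ = Complex.exp z • ψ) (l : ℤ) : (U ^ l) ψ = Complex.exp (z * l) • ψ := by
  have hinv : U⁻¹ ψ = Complex.exp (-z) • ψ := by
    have h1 : U (Complex.exp (-z) • ψ) = ψ := by
      rw [map_smul, h, smul_smul, ← Complex.exp_add]; simp
    conv_lhs => rw [← h1]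
    exact U.symm_apply_apply _
  induction l with
  | zero => simp
  | succ n ih =>
    rw [zpow_add_one, LinearIsometryEquiv.coe_mul, Function.comp_apply, h, map_smul, ih, smul_smul,
      ← Complex.exp_add]
    congr 2; push_cast; ring
  | pred n ih =>
    rw [zpow_sub_one, LinearIsometryEquiv.coe_mul, Function.comp_apply, hinv, map_smul, ih, smul_smul,
      ← Complex.exp_add]
    congr 2; push_cast; ring


/-- Corollary 1: the truncated Gaussian-weighted power sum of a unitary `U`
acts approximately as the identity on an eigenvector of eigenvalue 1 and approximately
annihilates eigenvectors whose eigenphase lies in `[Δ, 2π−Δ]`. -/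
theorem stmt_3 {H : Type*} [NormedAddCommGroup H] [InnerProductSpace ℂ H]
    [FiniteDimensional ℂ H] (U : H ≃ₗᵢ[ℂ] H)
    (ε Δ δz : ℝ) (L : ℤ)
    (hε : 0 < ε) (hε' : ε ≤ 1 / 5)
    (hΔ : 0 < Δ) (hΔ' : Δ ≤ Real.pi)
    (hδz : 0 < δz) (hδz' : δz ≤ Δ / Real.sqrt (2 * Real.log (20 / ε)))
    (hL : 2 ≤ L) (hLδz : Real.sqrt (2 * Real.log (20 / ε)) ≤ ((L : ℝ) - 1) * δz) :
    (∀ ψ₀ : H, ‖ψ₀‖ = 1 → U ψ₀ = ψ₀ →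
      ‖(∑ l ∈ Finset.Icc (-L) (L - 1),
          ((δz / Real.sqrt (2 * Real.pi) * Real.exp (-((l : ℝ) * δz) ^ 2 / 2) : ℝ) : ℂ) •
            (U ^ l) ψ₀) - ψ₀‖ ≤ ε) ∧
    (∀ (ψ : H) (lam : ℝ), ‖ψ‖ = 1 → Δ ≤ lam → lam ≤ 2 * Real.pi - Δ →
      U ψ = Complex.exp (Complex.I * lam) • ψ →
      ‖∑ l ∈ Finset.Icc (-L) (L - 1),
          ((δz / Real.sqrt (2 * Real.pi) * Real.exp (-((l : ℝ) * δz) ^ 2 / 2) : ℝ) : ℂ) •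
            (U ^ l) ψ‖ ≤ ε) := by
  obtain ⟨M, rfl⟩ := Int.eq_ofNat_of_zero_le (by omega : 0 ≤ L)
  have hx : 100 ≤ 20 / ε := by rw [le_div_iff₀ hε]; linarith
  have hlog : 1 / 2 ≤ Real.log (20 / ε) := by
    have h1 := Real.one_sub_inv_le_log_of_pos (by positivity : 0 < 20 / ε)
    have h2 : (20 / ε)⁻¹ ≤ 100⁻¹ := by gcongr
    linarith
  set s := Real.sqrt (2 * Real.log (20 / ε)) with hs
  have hs1 : 1 ≤ s := by rw [hs, Real.one_le_sqrt]; linarith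
  have hq : Real.exp (-s ^ 2 / 2) = ε / 20 := by
    rw [hs, Real.sq_sqrt (by linarith),
      show -(2 * Real.log (20 / ε)) / 2 = -Real.log (20 / ε) by ring, Real.exp_neg,
      Real.exp_log (by positivity), inv_div]
  have hsδ : s * δz ≤ Δ := by
    rw [le_div_iff₀ (by linarith)] at hδz'; linarith
  have hsδ0 : 0 < s * δz := by positivity
  have hpi := Real.pi_pos
  have hq' : Real.exp (-s ^ 2 / 2) ≤ 1 / 10 := by rw [hq]; linarith
  have hM : s ≤ ((M : ℝ) - 1) * δz := by simpa using hLδz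
  have hsum : ∀ (ψ : H) (lam : ℝ), U ψ = Complex.exp (Complex.I * lam) • ψ →
      ∑ l ∈ Finset.Icc (-(M : ℤ)) (M - 1),
        ((δz / Real.sqrt (2 * Real.pi) * Real.exp (-((l : ℝ) * δz) ^ 2 / 2) : ℝ) : ℂ) •
          (U ^ l) ψ =
      (∑ l ∈ Finset.Icc (-(M : ℤ)) (M - 1),
        (gaussianWeight δz l : ℂ) * Complex.exp (Complex.I * lam * l)) • ψ := by
    intro ψ lam h
    rw [Finset.sum_smul]
    refine Finset.sum_congr rfl fun l _ => ?_
    rw [zpow_apply_of_apply_eq_exp_smul U h, smul_smul, gaussianWeight]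
  constructor
  · intro ψ hψ hU
    have h := norm_sum_gaussianWeight_mul_exp_sub_le (lam := 0) (c := 1) hδz hs1 hq' hM
      (by simp [Real.exp_nonneg]) (by
        intro n _
        rw [sub_zero, abs_mul, abs_of_pos (by positivity : 0 < 2 * Real.pi), mul_comm]
        exact mul_le_mul_of_nonneg_right (by linarith) (abs_nonneg _))
    rw [hq, Complex.ofReal_one] at h
    rw [hsum ψ 0 (by simpa using hU)]
    nth_rewrite 2 [← one_smul ℂ ψ]
    rw [← sub_smul, norm_smul, hψ, mul_one]
    linarith
  · intro ψ lam hψ hl1 hl2 hU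
    have h := norm_sum_gaussianWeight_mul_exp_sub_le (lam := lam) (c := 0) hδz hs1 hq' hM
      (by
        rw [sub_zero, abs_of_pos (Real.exp_pos _), Real.exp_le_exp]
        have : s ≤ lam / δz := by rw [le_div_iff₀ hδz]; linarith
        have : s ^ 2 ≤ (lam / δz) ^ 2 := by gcongr
        linarith) (by
        intro n hn0
        rcases lt_or_gt_of_ne hn0 with hn | hn
        · have hn' : (n : ℝ) ≤ -1 := by exact_mod_cast (by omega : n ≤ -1)
          rw [abs_of_neg (by linarith), abs_of_neg (by nlinarith)]
          nlinarith
        · have hn' : (1 : ℝ) ≤ n := by exact_mod_cast hn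
          rw [abs_of_pos (by linarith), abs_of_pos (by nlinarith)]
          nlinarith [mul_nonneg (sub_nonneg.2 hn') (sub_nonneg.2 hΔ'),
            mul_nonneg (sub_nonneg.2 hn') hpi.le])
    rw [hq, Complex.ofReal_zero, sub_zero] at h
    rw [hsum ψ lam hU, norm_smul, hψ, mul_one]
    linarith
end
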